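/- arXiv:0801.1972 — 6 statements merged into one kernel-verified Lean document; each statement's English description precedes it below -/
import Mathlib

section
/- Let n ≥ 1 and let A and B be n×n complex matrices. If there exists a nonzero n×n complex matrix X such that XA = BX, then there exists a nonzero n×n complex matrix Y such that YB = AY. -/
open Polynomial in
/-- An intertwining relation extends to all polynomials in the two elements. -/
theorem SemiconjBy.polynomial_aeval {R S : Type*} [CommSemiring R] [Semiring S] [Algebra R S]
    {x a b : S} (h : SemiconjBy x a b) (p : R[X]) : SemiconjBy x (aeval a p) (aeval b p) := by
  induction p using Polynomial.induction_on' with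
  | add p q hp hq => simpa using hp.add_right hq
  | monomial k r =>
    simp only [aeval_monomial]
    exact SemiconjBy.mul_right (Algebra.commutes r x).symm (h.pow_right k)

namespace Matrix

variable {m K : Type*} [Fintype m] [DecidableEq m] [Field K]

theorem not_isCoprime_charpoly_of_semiconjBy {X A B : Matrix m m K}
    (hX : X ≠ 0) (h : SemiconjBy X A B) : ¬ IsCoprime A.charpoly B.charpoly := by
  rintro ⟨u, v, huv⟩
  have hA : Polynomial.aeval A (v * B.charpoly) = 1 := by
    simpa [aeval_self_charpoly] using congrArg (Polynomial.aeval A) huv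
  have hB : Polynomial.aeval B (v * B.charpoly) = 0 := by
    simp [aeval_self_charpoly]
  have hXv := (h.polynomial_aeval (v * B.charpoly)).eq
  rw [hA, hB, mul_one, zero_mul] at hXv
  exact hX hXv

theorem exists_ne_zero_semiconjBy_of_isRoot_charpoly {A B : Matrix m m K} {c : K}
    (hA : A.charpoly.IsRoot c) (hB : B.charpoly.IsRoot c) :
    ∃ Y : Matrix m m K, Y ≠ 0 ∧ SemiconjBy Y B A := by
  rw [Polynomial.IsRoot, eval_charpoly] at hA hB
  obtain ⟨v, hv, hAv⟩ := exists_mulVec_eq_zero_iff.mpr hA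
  obtain ⟨w, hw, hwB⟩ := exists_vecMul_eq_zero_iff.mpr hB
  refine ⟨vecMulVec v w, vecMulVec_ne_zero hv hw, ?_⟩
  have hv' : A *ᵥ v = c • v := by
    simpa [sub_mulVec, sub_eq_zero, eq_comm] using hAv
  have hw' : w ᵥ* B = c • w := by
    simpa [vecMul_sub, sub_eq_zero, eq_comm] using hwB
  rw [SemiconjBy, vecMulVec_mul, mul_vecMulVec, hv', hw', vecMulVec_smul, smul_vecMulVec]

end Matrix

theorem stmt_0 (n : ℕ) (hn : 1 ≤ n) (A B : Matrix (Fin n) (Fin n) ℂ)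
    (X : Matrix (Fin n) (Fin n) ℂ) (hX : X ≠ 0) (hXA : X * A = B * X) :
    ∃ Y : Matrix (Fin n) (Fin n) ℂ, Y ≠ 0 ∧ Y * B = A * Y := by
  have hcop := Matrix.not_isCoprime_charpoly_of_semiconjBy hX hXA
  rw [Polynomial.isCoprime_iff_aeval_ne_zero_of_isAlgClosed ℂ ℂ] at hcop
  push Not at hcop
  obtain ⟨c, hA, hB⟩ := hcop
  exact Matrix.exists_ne_zero_semiconjBy_of_isRoot_charpoly (c := c)
    (by simpa using hA) (by simpa using hB)
end

section
/- Let E be a nontrivial complex normed space and let A, B, X be bounded linear operators on E such that ‖A‖ ≤ 1 and ‖B h‖ ≥ 2‖h‖ for every h ∈ E. If XA = BX, then X = 0. -/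
theorem stmt_4 (E : Type*) [NormedAddCommGroup E] [NormedSpace ℂ E] [Nontrivial E]
    (A B X : E →L[ℂ] E) (hA : ‖A‖ ≤ 1) (hB : ∀ h : E, 2 * ‖h‖ ≤ ‖B h‖)
    (hXA : X ∘L A = B ∘L X) : X = 0 := by
  have norm_le_half : ‖X‖ ≤ ‖X‖ / 2 := by
    refine X.opNorm_le_bound (by positivity) fun g => ?_
    have hg : X (A g) = B (X g) := DFunLike.congr_fun hXA g
    have key : 2 * ‖X g‖ ≤ ‖X‖ * ‖g‖ := calc
      2 * ‖X g‖ ≤ ‖B (X g)‖ := hB (X g)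
      _ = ‖X (A g)‖ := by rw [hg]
      _ ≤ ‖X‖ * ‖A g‖ := X.le_opNorm (A g)
      _ ≤ ‖X‖ * ‖g‖ := by
        gcongr
        simpa using A.le_of_opNorm_le hA g
    linarith
  exact norm_le_zero_iff.mp (by linarith)
end

section
/- Let H be a complex Hilbert space and let S be a completely nonunitary isometry on H, i.e., a bounded linear operator with ‖Sx‖ = ‖x‖ for all x ∈ H and with ⋂_{n=0}^∞ Sⁿ(H) = {0}. Let A and X be bounded linear operators on H with X ≠ 0 and XA = SX. Then every complex number λ with |λ| < 1 is an eigenvalue of the Hilbert-space adjoint A*; that is, for each such λ there exists a nonzero v ∈ H with A* v = λ v. -/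
open ContinuousLinearMap

/-- An isometry `V` such that `V - μ` is surjective for some `‖μ‖ < 1` is itself surjective. -/
theorem surjective_of_isometry_of_surjective_sub_smul {E : Type*} [NormedAddCommGroup E]
    [InnerProductSpace ℂ E] [CompleteSpace E] (V : E →L[ℂ] E) (hV : ∀ x, ‖V x‖ = ‖x‖)
    {μ : ℂ} (hμ : ‖μ‖ < 1) (hsurj : ∀ y, ∃ x, V x - μ • x = y) (y : E) : ∃ x, V x = y := by
  have hadj : ∀ x, adjoint V (V x) = x := fun x ↦
    DFunLike.congr_fun ((norm_map_iff_adjoint_comp_self V).1 hV) x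
  have hnorm : ‖(starRingEnd ℂ μ) • V‖ < 1 := by
    have hle : ‖V‖ ≤ 1 := V.opNorm_le_bound zero_le_one fun x ↦ by simp [hV]
    rw [norm_smul, RCLike.norm_conj]
    nlinarith [norm_nonneg μ, norm_nonneg V]
  have hunit := isUnit_one_sub_of_norm_lt_one hnorm
  have hker : V.rangeᗮ = ⊥ := by
    rw [orthogonal_range, Submodule.eq_bot_iff]
    intro w hw
    have hw' : adjoint V w = 0 := hw
    obtain ⟨v, rfl⟩ := (ContinuousLinearMap.isUnit_iff_bijective.1 hunit).2 w
    have hv : adjoint V v = (starRingEnd ℂ μ) • v := by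
      simpa [hadj, sub_eq_zero] using hw'
    obtain ⟨x, hx⟩ := hsurj v
    have hv0 : inner ℂ v v = (0 : ℂ) := by
      nth_rewrite 2 [← hx]
      rw [inner_sub_right, ← adjoint_inner_left, hv, inner_smul_left, inner_smul_right]
      simp
    rw [inner_self_eq_zero.1 hv0, map_zero]
  have hclosed : IsClosed (V.range : Set E) :=
    (AddMonoidHomClass.isometry_of_norm V hV).isClosedEmbedding.isClosed_range
  have htop : V.range = ⊤ := by
    have := hclosed.completeSpace_coe
    exact (Submodule.orthogonal_eq_bot_iff).1 hker
  exact LinearMap.range_eq_top.1 htop y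

section

variable {H : Type*} [NormedAddCommGroup H] [InnerProductSpace ℂ H]

theorem antilipschitzWith_pow {𝕜 E : Type*} [NontriviallyNormedField 𝕜] [NormedAddCommGroup E]
    [NormedSpace 𝕜 E] {B : E →L[𝕜] E} {K : NNReal} (hB : AntilipschitzWith K B) (n : ℕ) :
    AntilipschitzWith (K ^ n) (B ^ n : E →L[𝕜] E) := by
  induction n with
  | zero => simpa using! AntilipschitzWith.id
  | succ n ih =>
    rw [pow_succ', pow_succ]
    exact ih.comp hB

theorem antilipschitzWith_sub_smul_of_isometry {S : H →L[ℂ] H} (hS : ∀ x, ‖S x‖ = ‖x‖)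
    {μ : ℂ} (hμ : ‖μ‖ < 1) :
    AntilipschitzWith (1 - ‖μ‖).toNNReal⁻¹ (S - μ • 1 : H →L[ℂ] H) := by
  have hpos : 0 < 1 - ‖μ‖ := sub_pos.2 hμ
  refine AddMonoidHomClass.antilipschitz_of_bound _ fun x ↦ ?_
  rw [NNReal.coe_inv, Real.coe_toNNReal _ hpos.le, inv_mul_eq_div, le_div_iff₀ hpos]
  have h := norm_sub_norm_le (S x) (μ • x)
  rw [hS, norm_smul] at h
  simp only [sub_apply, smul_apply, one_apply_eq_self]
  linarith

/-- For a completely nonunitary isometry `S` and `‖μ‖ < 1`, the ranges of the powers of `S - μ`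
have trivial intersection. -/
theorem eq_zero_of_forall_mem_range_sub_smul_pow [CompleteSpace H] {S : H →L[ℂ] H}
    (hS : ∀ x, ‖S x‖ = ‖x‖) (hcnu : (⋂ n : ℕ, Set.range ⇑(S ^ n)) = {0})
    {μ : ℂ} (hμ : ‖μ‖ < 1) {x : H} (hx : ∀ n : ℕ, x ∈ ((S - μ • 1) ^ n).range) : x = 0 := by
  set B : H →L[ℂ] H := S - μ • 1 with hB
  have hanti : AntilipschitzWith _ B := antilipschitzWith_sub_smul_of_isometry hS hμ
  let M : Submodule ℂ H := ⨅ n : ℕ, (B ^ n).range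
  have hM : ∀ {y}, y ∈ M ↔ ∀ n : ℕ, ∃ z, (B ^ n) z = y :=
    Submodule.mem_iInf _
  have hclosed : IsClosed (M : Set H) := by
    simp only [M, Submodule.coe_iInf]
    exact isClosed_iInter fun n ↦
      (antilipschitzWith_pow hanti n).isClosed_range (B ^ n).uniformContinuous
  have := hclosed.completeSpace_coe
  have hcomm : Commute S B := (Commute.refl S).sub_right ((Commute.one_right S).smul_right μ)
  have hSM : ∀ y ∈ M, S y ∈ M := by
    intro y hy
    refine hM.2 fun n ↦ ?_
    obtain ⟨z, rfl⟩ := hM.1 hy n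
    exact ⟨S z, DFunLike.congr_fun (hcomm.pow_right n).eq.symm z⟩
  let V : M →L[ℂ] M := (S ∘L M.subtypeL).codRestrict M fun y ↦ hSM y y.2
  have hV : ∀ y, ((V y : M) : H) = S y := fun _ ↦ rfl
  have hVsurj := surjective_of_isometry_of_surjective_sub_smul V (fun y ↦ hS y) hμ (by
    rintro ⟨y, hy⟩
    obtain ⟨z, hz⟩ := hM.1 hy 1
    rw [pow_one] at hz
    have hzM : z ∈ M := by
      refine hM.2 fun n ↦ ?_
      obtain ⟨u, hu⟩ := hM.1 hy (n + 1)
      refine ⟨u, hanti.injective ?_⟩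
      rw [hz, ← hu, pow_succ']
      rfl
    refine ⟨⟨z, hzM⟩, Subtype.ext ?_⟩
    simpa [hB, hV] using hz)
  have hpow : ∀ n : ℕ, ∀ y ∈ M, ∃ z ∈ M, (S ^ n) z = y := by
    intro n
    induction n with
    | zero => exact fun y hy ↦ ⟨y, hy, by simp⟩
    | succ n ih =>
      intro y hy
      obtain ⟨z, hz, rfl⟩ := ih y hy
      obtain ⟨u, hu⟩ := hVsurj ⟨z, hz⟩
      refine ⟨u, u.2, ?_⟩
      rw [pow_succ, mul_apply_eq_comp, ← hV, hu]
  have hxM : x ∈ M := (Submodule.mem_iInf _).2 hx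
  have hmem : x ∈ ⋂ n : ℕ, Set.range ⇑(S ^ n) :=
    Set.mem_iInter.2 fun n ↦ (hpow n x hxM).imp fun _ h ↦ h.2
  rwa [hcnu] at hmem

end

theorem stmt_5 (H : Type*) [NormedAddCommGroup H] [InnerProductSpace ℂ H] [CompleteSpace H]
    (S A X : H →L[ℂ] H)
    (hiso : ∀ x : H, ‖S x‖ = ‖x‖)
    (hcnu : (⋂ n : ℕ, Set.range ⇑(S ^ n)) = {0})
    (hX : X ≠ 0) (hXA : X ∘L A = S ∘L X) :
    ∀ lam : ℂ, ‖lam‖ < 1 →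
      ∃ v : H, v ≠ 0 ∧ ContinuousLinearMap.adjoint A v = lam • v := by
  intro lam hlam
  by_contra! hno
  set μ : ℂ := starRingEnd ℂ lam with hμdef
  have hμ : ‖μ‖ < 1 := by rwa [hμdef, RCLike.norm_conj]
  set D : H →L[ℂ] H := A - μ • 1 with hD
  set B : H →L[ℂ] H := S - μ • 1 with hB
  -- Without the eigenvalue `lam`, the operator `A - μ` has dense range.
  have hdense : DenseRange D := by
    have hbot : D.rangeᗮ = ⊥ := by
      rw [orthogonal_range, Submodule.eq_bot_iff]
      intro v hv
      by_contra hv0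
      refine hno v hv0 (ext_inner_right ℂ fun y ↦ ?_)
      have h : inner ℂ (adjoint D v) y = (0 : ℂ) := by
        rw [show adjoint D v = 0 from hv, inner_zero_left]
      rw [adjoint_inner_left] at h
      rw [adjoint_inner_left, inner_smul_left, ← hμdef, ← inner_smul_right]
      simpa [hD, inner_sub_right, sub_eq_zero] using h
    have := (Submodule.topologicalClosure_eq_top_iff).2 hbot
    exact (Submodule.dense_iff_topologicalClosure_eq_top).2 this
  have hdense_pow : ∀ n : ℕ, DenseRange (D ^ n : H →L[ℂ] H) := by
    intro n
    induction n with
    | zero => exact Function.surjective_id.denseRange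
    | succ n ih =>
      rw [pow_succ]
      exact ih.comp hdense (D ^ n).continuous
  have hsemi : SemiconjBy X D B :=
    SemiconjBy.sub_right (show SemiconjBy X A S from hXA)
      (show X * (μ • 1) = (μ • 1) * X by simp)
  refine hX (ContinuousLinearMap.ext fun x ↦
    eq_zero_of_forall_mem_range_sub_smul_pow hiso hcnu hμ fun n ↦ ?_)
  have hclosed : IsClosed (Set.range (B ^ n : H →L[ℂ] H)) :=
    (antilipschitzWith_pow (antilipschitzWith_sub_smul_of_isometry hiso hμ) n).isClosed_range
      (B ^ n).uniformContinuous
  refine (hdense_pow n).induction_on (p := fun x ↦ X x ∈ Set.range (B ^ n : H →L[ℂ] H)) x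
    (hclosed.preimage X.continuous) fun y ↦ ⟨X y, ?_⟩
  exact DFunLike.congr_fun (hsemi.pow_right n).eq.symm y
end

section
/- Let H be a complex Hilbert space, let S be a bounded linear operator on H that is an isometry (‖Sx‖ = ‖x‖ for all x), let w ∈ ker S* (where S* is the Hilbert-space adjoint), and let λ ∈ ℂ with |λ| < 1. For each integer N ≥ 0 define K_N(λ,w) = ∑_{n=0}^∞ c_{N,n} λⁿ S^{N+n} w, where c_{N,n} = (n+1)(n+2)⋯(n+N) = (n+N)!/n! (so c_{0,n} = 1). Then for every N ≥ 1, (S* − λ I) K_N(λ,w) = N · K_{N−1}(λ,w). -/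
/-- `c N n = (n+1)(n+2)⋯(n+N)`. -/
def intertwineCoeff (N n : ℕ) : ℕ := ∏ i ∈ Finset.range N, (n + i + 1)

theorem intertwineCoeff_succ (N n : ℕ) :
    intertwineCoeff (N + 1) n = (n + N + 1) * intertwineCoeff N n := by
  rw [intertwineCoeff, Finset.prod_range_succ, mul_comm, intertwineCoeff]

theorem intertwineCoeff_succ' (N n : ℕ) :
    intertwineCoeff (N + 1) n = (n + 1) * intertwineCoeff N (n + 1) := by
  rw [intertwineCoeff, Finset.prod_range_succ', mul_comm, intertwineCoeff]
  congr 1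
  exact Finset.prod_congr rfl fun i _ => by ring

theorem intertwineCoeff_succ_succ (N n : ℕ) :
    intertwineCoeff (N + 1) (n + 1) =
      intertwineCoeff (N + 1) n + (N + 1) * intertwineCoeff N (n + 1) := by
  rw [intertwineCoeff_succ, intertwineCoeff_succ']
  ring

theorem intertwineCoeff_eq_descFactorial (N n : ℕ) :
    intertwineCoeff N n = (n + N).descFactorial N := by
  induction N with
  | zero => simp [intertwineCoeff]
  | succ N ih => rw [intertwineCoeff_succ, ih, ← add_assoc, Nat.succ_descFactorial_succ]

theorem norm_pow_apply_of_isometry {H : Type*} [NormedAddCommGroup H] [NormedSpace ℂ H]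
    {S : H →L[ℂ] H} (hiso : ∀ x : H, ‖S x‖ = ‖x‖) (n : ℕ) (x : H) :
    ‖(S ^ n) x‖ = ‖x‖ := by
  induction n with
  | zero => simp
  | succ n ih => rw [pow_succ', ContinuousLinearMap.mul_def, ContinuousLinearMap.comp_apply, hiso, ih]

theorem summable_intertwineCoeff_smul {H : Type*} [NormedAddCommGroup H] [NormedSpace ℂ H]
    [CompleteSpace H] {S : H →L[ℂ] H} (hiso : ∀ x : H, ‖S x‖ = ‖x‖) (w : H)
    {lam : ℂ} (hlam : ‖lam‖ < 1) (N M : ℕ) :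
    Summable fun n : ℕ => (intertwineCoeff N n : ℂ) • lam ^ n • (S ^ (M + n)) w := by
  have hgeom := (summable_descFactorial_mul_geometric_of_norm_lt_one (R := ℝ) N
    (r := ‖lam‖) (by simpa using hlam)).mul_right ‖w‖
  refine Summable.of_norm (hgeom.congr fun n => ?_)
  rw [norm_smul, norm_smul, norm_pow, norm_pow_apply_of_isometry hiso, Complex.norm_natCast,
    intertwineCoeff_eq_descFactorial, mul_assoc]

theorem adjoint_pow_succ_apply_of_isometry {H : Type*} [NormedAddCommGroup H]
    [InnerProductSpace ℂ H] [CompleteSpace H] {S : H →L[ℂ] H} (hiso : ∀ x : H, ‖S x‖ = ‖x‖)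
    (n : ℕ) (x : H) :
    ContinuousLinearMap.adjoint S ((S ^ (n + 1)) x) = (S ^ n) x := by
  have h := S.norm_map_iff_adjoint_comp_self.mp hiso
  rw [pow_succ', ContinuousLinearMap.mul_def, ContinuousLinearMap.comp_apply]
  exact DFunLike.congr_fun h ((S ^ n) x)

theorem stmt_7 (H : Type*) [NormedAddCommGroup H] [InnerProductSpace ℂ H] [CompleteSpace H]
    (S : H →L[ℂ] H) (hiso : ∀ x : H, ‖S x‖ = ‖x‖)
    (w : H) (hw : ContinuousLinearMap.adjoint S w = 0)
    (lam : ℂ) (hlam : ‖lam‖ < 1) (N : ℕ) (hN : 1 ≤ N) :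
    ContinuousLinearMap.adjoint S
        (∑' n : ℕ, (intertwineCoeff N n : ℂ) • lam ^ n • (S ^ (N + n)) w)
      - lam • (∑' n : ℕ, (intertwineCoeff N n : ℂ) • lam ^ n • (S ^ (N + n)) w)
      = (N : ℂ) • ∑' n : ℕ, (intertwineCoeff (N - 1) n : ℂ) • lam ^ n • (S ^ (N - 1 + n)) w := by
  obtain ⟨M, rfl⟩ : ∃ M, N = M + 1 := ⟨N - 1, by omega⟩
  have hsum := summable_intertwineCoeff_smul hiso w hlam (M + 1) (M + 1)
  have hsum_adj := summable_intertwineCoeff_smul hiso w hlam (M + 1) M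
  have hsum_pred := summable_intertwineCoeff_smul hiso w hlam M M
  have hadj (n : ℕ) : ContinuousLinearMap.adjoint S
      ((intertwineCoeff (M + 1) n : ℂ) • lam ^ n • (S ^ (M + 1 + n)) w) =
      (intertwineCoeff (M + 1) n : ℂ) • lam ^ n • (S ^ (M + n)) w := by
    rw [map_smul, map_smul, Nat.add_right_comm M 1 n, adjoint_pow_succ_apply_of_isometry hiso]
  rw [ContinuousLinearMap.map_tsum _ hsum, tsum_congr hadj, Nat.add_sub_cancel,
    hsum_adj.tsum_eq_zero_add, hsum_pred.tsum_eq_zero_add, add_sub_assoc, ← hsum.tsum_const_smul lam,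
    ← ((summable_nat_add_iff 1).mpr hsum_adj).tsum_sub (hsum.const_smul lam), smul_add,
    ← ((summable_nat_add_iff 1).mpr hsum_pred).tsum_const_smul]
  congr 1
  · rw [intertwineCoeff_succ, zero_add, Nat.cast_mul, mul_smul]
  · refine tsum_congr fun n => ?_
    rw [intertwineCoeff_succ_succ, Nat.add_right_comm M 1 n, ← add_assoc M n 1]
    push_cast
    module
end

section
/- There exist a nontrivial complex Hilbert space H and bounded linear operators S, A, X on H such that: S is an isometry (‖Sx‖ = ‖x‖ for all x) that is not surjective (hence S is a nonunitary isometry); X ≠ 0; XA = SX; and every eigenvalue μ of the Hilbert-space adjoint A* satisfies |μ| = 1 or μ = 0. In particular, the point spectrum of A* does not contain the open unit disc. -/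
/-- An eigenvalue of an idempotent operator is `1` or `0`. -/
theorem eigenvalue_eq_one_or_zero_of_isIdempotentElem {E : Type*} [NormedAddCommGroup E]
    [NormedSpace ℂ E] {P : E →L[ℂ] E} (hP : IsIdempotentElem P) {μ : ℂ} {v : E} (hv : v ≠ 0)
    (h : P v = μ • v) : μ = 1 ∨ μ = 0 := by
  have hPP : P (P v) = P v := congrArg (fun T : E →L[ℂ] E => T v) hP.eq
  rw [h, map_smul, h, smul_smul] at hPP
  have hμ : μ * μ = μ := smul_left_injective ℂ hv hPP
  rcases eq_or_ne μ 0 with h0 | h0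
  · exact Or.inr h0
  · exact Or.inl (mul_right_cancel₀ h0 (by rw [hμ, one_mul]))

/-- Along an injective, non-surjective reindexing, a Hilbert basis is moved by a
non-surjective isometry. -/
theorem HilbertBasis.exists_isometry_not_surjective {ι E : Type*} [NormedAddCommGroup E]
    [InnerProductSpace ℂ E] [CompleteSpace E] (b : HilbertBasis ι ℂ E) {f : ι → ι}
    (hf : Function.Injective f) (hf' : ¬ Function.Surjective f) :
    ∃ S : E →ₗᵢ[ℂ] E, (∀ i, S (b i) = b (f i)) ∧ ¬ Function.Surjective S := by
  classical
  have hV := (b.orthonormal.comp f hf).orthogonalFamily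
  refine ⟨hV.linearIsometry.comp b.repr.toLinearIsometry, fun i => ?_, fun hS => hf' fun j => ?_⟩
  · simp [b.repr_self, hV.linearIsometry_apply_single]
  · by_contra! hj
    obtain ⟨x, hx⟩ := hS (b j)
    have hsum := (hV.hasSum_linearIsometry (b.repr x)).mapL (innerSL ℂ (b j))
    have hzero : ∀ i, inner ℂ (b j) (b (f i)) = 0 := fun i => b.orthonormal.2 (hj i).symm
    have hx' : hV.linearIsometry (b.repr x) = b j := hx
    rw [hx'] at hsum
    simp [hzero, b.orthonormal.1 j] at hsum
    exact one_ne_zero (hsum.unique hasSum_zero)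

theorem stmt_10 :
    ∃ (H : Type) (_ : NormedAddCommGroup H) (_ : InnerProductSpace ℂ H)
      (_ : CompleteSpace H) (_ : Nontrivial H) (S A X : H →L[ℂ] H),
      (∀ x : H, ‖S x‖ = ‖x‖) ∧ ¬ Function.Surjective ⇑S ∧
      X ≠ 0 ∧ X ∘L A = S ∘L X ∧
      (∀ μ : ℂ, (∃ v : H, v ≠ 0 ∧ ContinuousLinearMap.adjoint A v = μ • v) →
        ‖μ‖ = 1 ∨ μ = 0) := by
  let b : HilbertBasis ℕ ℂ (lp (fun _ : ℕ => ℂ) 2) := ⟨LinearIsometryEquiv.refl ℂ _⟩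
  let f : ℕ → ℕ := fun n => if n = 0 then 0 else n + 1
  have hf : Function.Injective f := by intro m n h; grind
  have hf' : ¬ Function.Surjective f := fun h => by obtain ⟨n, hn⟩ := h 1; grind
  obtain ⟨S, hSb, hS⟩ := b.exists_isometry_not_surjective hf hf'
  have hb : ‖b 0‖ = 1 := b.orthonormal.1 0
  have hb0 : b 0 ≠ 0 := b.orthonormal.ne_zero 0
  have hSb0 : S (b 0) = b 0 := hSb 0
  let P := InnerProductSpace.rankOne ℂ (b 0) (b 0)
  have hPb : P (b 0) = b 0 := by simp [P, hb]
  have hP : IsIdempotentElem P := by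
    ext1 x
    simp [P, hb]
  refine ⟨_, inferInstance, inferInstance, inferInstance, ⟨b 0, 0, hb0⟩,
    S.toContinuousLinearMap, P, P, S.norm_map, hS, fun h => hb0 ?_, ?_, ?_⟩
  · rw [← hPb, h, zero_apply]
  · refine hP.eq.trans ?_
    ext1 x
    simp [P, hSb0]
  · rintro μ ⟨v, hv, h⟩
    rw [InnerProductSpace.adjoint_rankOne] at h
    refine (eigenvalue_eq_one_or_zero_of_isIdempotentElem hP hv h).imp_left fun hμ => ?_
    rw [hμ, norm_one]
end

section
/- Let φ : ℂ → ℂ be given by φ(z) = z² + z. Then the open unit disc is contained in the image of the open unit disc under φ, which in turn is contained in the open disc of radius 2: {w ∈ ℂ : |w| < 1} ⊆ φ({z ∈ ℂ : |z| < 1}) ⊆ {w ∈ ℂ : |w| < 2}. -/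
theorem stmt_14 :
    Metric.ball (0 : ℂ) 1 ⊆ (fun z : ℂ => z ^ 2 + z) '' Metric.ball (0 : ℂ) 1 ∧
      (fun z : ℂ => z ^ 2 + z) '' Metric.ball (0 : ℂ) 1 ⊆ Metric.ball (0 : ℂ) 2 := by
  constructor
  · intro w hw
    rw [mem_ball_zero_iff] at hw
    obtain ⟨s, hs⟩ := IsAlgClosed.exists_eq_mul_self (1 + 4 * w)
    -- The two roots of `z ^ 2 + z = w` have product `-w`, so one of them lies in the disc.
    have hprod : ‖(s - 1) / 2‖ * ‖(-s - 1) / 2‖ < 1 := by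
      rw [← norm_mul, show (s - 1) / 2 * ((-s - 1) / 2) = -w by linear_combination hs / 4,
        norm_neg]
      exact hw
    by_cases h : ‖(s - 1) / 2‖ < 1
    · exact ⟨(s - 1) / 2, mem_ball_zero_iff.2 h, by linear_combination -hs / 4⟩
    · refine ⟨(-s - 1) / 2, mem_ball_zero_iff.2 ?_, by linear_combination -hs / 4⟩
      by_contra h'
      exact hprod.not_ge (one_le_mul_of_one_le_of_one_le (not_lt.1 h) (not_lt.1 h'))
  · rintro _ ⟨z, hz, rfl⟩
    rw [mem_ball_zero_iff] at hz ⊢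
    calc ‖z ^ 2 + z‖ ≤ ‖z‖ ^ 2 + ‖z‖ := norm_pow z 2 ▸ norm_add_le (z ^ 2) z
      _ < 2 := by nlinarith [norm_nonneg z]
end
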